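/- Let λ ∈ ℝ, let φ(x) = (1+|x|^α)^{b/α}, let u: ℝ^N → ℝ be twice continuously differentiable and set v(x) = √(φ(x)) u(x). Then for every x ∈ ℝ^N with x ≠ 0: λu(x) − Au(x) = ((1+|x|^α)/√(φ(x))) · ( −Δv(x) + 𝒱_λ(x) v(x) ). -/

import Mathlib

open Real MeasureTheory Metric
open scoped ENNReal NNReal

/-- The `i`-th partial derivative of `u` at `x`. -/
noncomputable def pd {N : ℕ} {F : Type*} [NormedAddCommGroup F] [NormedSpace ℝ F]
    (u : EuclideanSpace ℝ (Fin N) → F) (i : Fin N) (x : EuclideanSpace ℝ (Fin N)) : F :=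
  fderiv ℝ u x (EuclideanSpace.single i 1)

/-- The Laplacian of `u` at `x`. -/
noncomputable def lap {N : ℕ} {F : Type*} [NormedAddCommGroup F] [NormedSpace ℝ F]
    (u : EuclideanSpace ℝ (Fin N) → F) (x : EuclideanSpace ℝ (Fin N)) : F :=
  ∑ i, pd (pd u i) i x

/-- The elliptic operator `Au = (1+|x|^α)Δu + b|x|^{α-2} x·∇u - c|x|^β u`. -/
noncomputable def opA {N : ℕ} (α β b c : ℝ) (u : EuclideanSpace ℝ (Fin N) → ℝ)
    (x : EuclideanSpace ℝ (Fin N)) : ℝ :=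
  (1 + ‖x‖ ^ α) * lap u x + b * ‖x‖ ^ (α - 2) * (∑ i, x i * pd u i x)
    - c * ‖x‖ ^ β * u x

/-- The potential `𝒱_λ` associated with the operator `A`. -/
noncomputable def pot (N : ℕ) (α β b c lam : ℝ) (x : EuclideanSpace ℝ (Fin N)) : ℝ :=
  (b ^ 2 / 4 - b * α / 2) * ‖x‖ ^ (2 * α - 2) / (1 + ‖x‖ ^ α) ^ 2
    + (b / 2) * ((N : ℝ) + α - 2) * ‖x‖ ^ (α - 2) / (1 + ‖x‖ ^ α)
    + (c * ‖x‖ ^ β + lam) / (1 + ‖x‖ ^ α)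

/-- The derivative of a power of the norm away from the origin. -/
lemma hasFDerivAt_normpow {N : ℕ} (p : ℝ) (y : EuclideanSpace ℝ (Fin N)) (hy : y ≠ 0) :
    HasFDerivAt (fun z : EuclideanSpace ℝ (Fin N) => ‖z‖ ^ p)
      ((p * ‖y‖ ^ (p - 2)) • innerSL ℝ y) y := by
  have hy0 : 0 < ‖y‖ := norm_pos_iff.mpr hy
  have h1 : HasFDerivAt (fun z : EuclideanSpace ℝ (Fin N) => ‖z‖ ^ 2)
      (2 • innerSL ℝ y) y := (hasStrictFDerivAt_norm_sq y).hasFDerivAt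
  have h2 := (Real.hasDerivAt_rpow_const (x := ‖y‖ ^ 2) (p := p / 2)
    (Or.inl (by positivity))).comp_hasFDerivAt y h1
  have e : ∀ (z : EuclideanSpace ℝ (Fin N)) (q : ℝ), (‖z‖ ^ 2) ^ (q / 2) = ‖z‖ ^ q := by
    intro z q
    rw [← Real.rpow_natCast, ← Real.rpow_mul (norm_nonneg z)]
    congr 1
    push_cast
    ring
  have h3 : HasFDerivAt (fun z : EuclideanSpace ℝ (Fin N) => ‖z‖ ^ p)
      ((p / 2 * (‖y‖ ^ 2) ^ (p / 2 - 1)) • (2 • innerSL ℝ y)) y := by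
    refine h2.congr_of_eventuallyEq (Filter.Eventually.of_forall fun z => ?_)
    exact (e z p).symm
  have h4 : p / 2 - 1 = (p - 2) / 2 := by ring
  have h5 : p / 2 * ‖y‖ ^ (p - 2) * ((2 : ℕ) : ℝ) = p * ‖y‖ ^ (p - 2) := by
    push_cast
    ring
  rw [h4, e, ← Nat.cast_smul_eq_nsmul ℝ, smul_smul, h5] at h3
  exact h3

/-- The derivative of a power of `1 + |x|^α` away from the origin. -/
lemma hasFDerivAt_Ppow {N : ℕ} (α k : ℝ) (y : EuclideanSpace ℝ (Fin N)) (hy : y ≠ 0) :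
    HasFDerivAt (fun z : EuclideanSpace ℝ (Fin N) => (1 + ‖z‖ ^ α) ^ k)
      ((k * (1 + ‖y‖ ^ α) ^ (k - 1) * (α * ‖y‖ ^ (α - 2))) • innerSL ℝ y) y := by
  have hP : 0 < 1 + ‖y‖ ^ α := by positivity
  have h2 := (Real.hasDerivAt_rpow_const (x := 1 + ‖y‖ ^ α) (p := k)
    (Or.inl hP.ne')).comp_hasFDerivAt y ((hasFDerivAt_normpow α y hy).const_add 1)
  rw [smul_smul] at h2
  exact h2

lemma inner_single_one {N : ℕ} (y : EuclideanSpace ℝ (Fin N)) (i : Fin N) :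
    innerSL ℝ y (EuclideanSpace.single i 1) = y i := by
  rw [innerSL_apply_apply, EuclideanSpace.inner_single_right]
  simp

lemma hasFDerivAt_coord {N : ℕ} (y : EuclideanSpace ℝ (Fin N)) (i : Fin N) :
    HasFDerivAt (fun z : EuclideanSpace ℝ (Fin N) => z i)
      (EuclideanSpace.proj i : EuclideanSpace ℝ (Fin N) →L[ℝ] ℝ) y :=
  (EuclideanSpace.proj i : EuclideanSpace ℝ (Fin N) →L[ℝ] ℝ).hasFDerivAt

/-- Second partial derivative of the product, abstractly. -/
lemma pd_pd_mul {N : ℕ} (α k : ℝ) (u : EuclideanSpace ℝ (Fin N) → ℝ) (hu : ContDiff ℝ 2 u)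
    (x : EuclideanSpace ℝ (Fin N)) (hx : x ≠ 0) (i : Fin N) :
    pd (pd (fun y => (1 + ‖y‖ ^ α) ^ k * u y) i) i x =
      (1 + ‖x‖ ^ α) ^ k * pd (pd u i) i x
      + (2 * k * α * (1 + ‖x‖ ^ α) ^ (k - 1) * ‖x‖ ^ (α - 2)) * (x i * pd u i x)
      + (k * α * (1 + ‖x‖ ^ α) ^ (k - 1) * ‖x‖ ^ (α - 2)) * u x
      + (k * α * ((k - 1) * α * (1 + ‖x‖ ^ α) ^ (k - 1 - 1) * (‖x‖ ^ (α - 2)) ^ 2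
          + (1 + ‖x‖ ^ α) ^ (k - 1) * (α - 2) * ‖x‖ ^ (α - 2 - 2)) * u x) * (x i) ^ 2 := by
  have hud : ∀ y, HasFDerivAt u (fderiv ℝ u y) y := fun y =>
    (hu.differentiable (by norm_num) y).hasFDerivAt
  have hpd : HasFDerivAt (pd u i) (fderiv ℝ (pd u i) x) x := by
    apply DifferentiableAt.hasFDerivAt
    have h1 : ContDiff ℝ 1 (fderiv ℝ u) := hu.fderiv_right (by norm_num)
    have h2 : Differentiable ℝ (fderiv ℝ u) := h1.differentiable (by norm_num)
    exact (h2 x).clm_apply (differentiableAt_const _)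
  have hev : pd (fun y => (1 + ‖y‖ ^ α) ^ k * u y) i =ᶠ[nhds x] fun y =>
      (1 + ‖y‖ ^ α) ^ k * pd u i y
        + (k * α) * ((1 + ‖y‖ ^ α) ^ (k - 1) * ‖y‖ ^ (α - 2) * (y i * u y)) := by
    filter_upwards [isOpen_ne.mem_nhds hx] with y hy
    have h := ((hasFDerivAt_Ppow α k y hy).mul (hud y)).fderiv
    change fderiv ℝ (fun y => (1 + ‖y‖ ^ α) ^ k * u y) y _ = _
    erw [h]
    simp only [add_apply, smul_apply, inner_single_one,
      smul_eq_mul, pd]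
    ring
  have hfin := ((hasFDerivAt_Ppow α k x hx).mul hpd).add
    ((((hasFDerivAt_Ppow α (k - 1) x hx).mul (hasFDerivAt_normpow (α - 2) x hx)).mul
      ((hasFDerivAt_coord x i).mul (hud x))).const_mul (k * α))
  have h := (hfin.congr_of_eventuallyEq hev).fderiv
  have hproj : (EuclideanSpace.proj i : EuclideanSpace ℝ (Fin N) →L[ℝ] ℝ)
      (EuclideanSpace.single i 1) = 1 := by
    change (EuclideanSpace.single i (1 : ℝ)) i = 1
    simp
  rw [pd, h]
  simp only [add_apply, smul_apply, inner_single_one,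
      smul_eq_mul, pd, hproj, Pi.mul_apply]
  ring

/-- Let `φ(x) = (1+|x|^α)^{b/α}` and `v = √φ · u` for a `C²` function
`u : ℝ^N → ℝ`. Then for every `x ≠ 0`:
`λu(x) - Au(x) = ((1+|x|^α)/√φ(x)) (-Δv(x) + 𝒱_λ(x) v(x))`. -/
theorem stmt12 (N : ℕ) (hN : 2 < N) (α β b c lam : ℝ) (hα : 2 < α) (hβ : α - 2 < β)
    (hc : 0 < c)
    (u : EuclideanSpace ℝ (Fin N) → ℝ) (hu : ContDiff ℝ 2 u)
    (x : EuclideanSpace ℝ (Fin N)) (hx : x ≠ 0) :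
    lam * u x - opA α β b c u x =
      ((1 + ‖x‖ ^ α) / Real.sqrt ((1 + ‖x‖ ^ α) ^ (b / α))) *
        (-(lap (fun y => Real.sqrt ((1 + ‖y‖ ^ α) ^ (b / α)) * u y) x)
          + pot N α β b c lam x *
            (Real.sqrt ((1 + ‖x‖ ^ α) ^ (b / α)) * u x)) := by
  have hr : 0 < ‖x‖ := norm_pos_iff.mpr hx
  have hP : 0 < 1 + ‖x‖ ^ α := by positivity
  have hα0 : α ≠ 0 := by linarith
  have hs : ∀ y : EuclideanSpace ℝ (Fin N),
      Real.sqrt ((1 + ‖y‖ ^ α) ^ (b / α)) = (1 + ‖y‖ ^ α) ^ (b / (2 * α)) := by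
    intro y
    have : 0 ≤ 1 + ‖y‖ ^ α := by positivity
    rw [Real.sqrt_eq_rpow, ← Real.rpow_mul this]
    congr 1
    field_simp
  simp only [hs]
  have hk : b = 2 * (b / (2 * α)) * α := by field_simp
  generalize b / (2 * α) = k at hk
  subst hk
  have hn : ∑ i, (x i) ^ 2 = ‖x‖ ^ 2 := (EuclideanSpace.real_norm_sq_eq x).symm
  have hl : lap (fun y => (1 + ‖y‖ ^ α) ^ k * u y) x =
      (1 + ‖x‖ ^ α) ^ k * lap u x
      + (2 * k * α * (1 + ‖x‖ ^ α) ^ (k - 1) * ‖x‖ ^ (α - 2)) * (∑ i, x i * pd u i x)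
      + N * ((k * α * (1 + ‖x‖ ^ α) ^ (k - 1) * ‖x‖ ^ (α - 2)) * u x)
      + (k * α * ((k - 1) * α * (1 + ‖x‖ ^ α) ^ (k - 1 - 1) * (‖x‖ ^ (α - 2)) ^ 2
          + (1 + ‖x‖ ^ α) ^ (k - 1) * (α - 2) * ‖x‖ ^ (α - 2 - 2)) * u x) * ‖x‖ ^ 2 := by
    rw [← hn]
    simp only [lap, pd_pd_mul α k u hu x hx, Finset.sum_add_distrib, ← Finset.mul_sum]
    simp
    ring
  have e1 : ‖x‖ ^ (2 * α - 2) = (‖x‖ ^ (α - 2)) ^ 2 * ‖x‖ ^ 2 := by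
    rw [← Real.rpow_natCast, ← Real.rpow_natCast, ← Real.rpow_mul hr.le, ← Real.rpow_add hr]
    congr 1
    push_cast
    ring
  have e2 : ‖x‖ ^ (α - 2 - 2) = ‖x‖ ^ (α - 2) / ‖x‖ ^ 2 := by
    rw [Real.rpow_sub hr (α - 2) 2, Real.rpow_two]
  have e3 : (1 + ‖x‖ ^ α) ^ (k - 1) = (1 + ‖x‖ ^ α) ^ k / (1 + ‖x‖ ^ α) :=
    Real.rpow_sub_one hP.ne' k
  have e4 : (1 + ‖x‖ ^ α) ^ (k - 1 - 1) = (1 + ‖x‖ ^ α) ^ k / (1 + ‖x‖ ^ α) ^ 2 := by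
    rw [Real.rpow_sub_one hP.ne', e3, div_div, sq]
  have hG : 0 < (1 + ‖x‖ ^ α) ^ k := by positivity
  rw [hl, opA, pot, e1, e2, e4, e3]
  generalize (1 + ‖x‖ ^ α) ^ k = G at *
  generalize 1 + ‖x‖ ^ α = P at *
  generalize ‖x‖ ^ (α - 2) = Q at *
  generalize ‖x‖ ^ β = B at *
  generalize ‖x‖ = r at *
  field_simp
  ring
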